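/- arXiv:1201.2040 — 2 statements merged into one kernel-verified Lean document; each statement's English description precedes it below -/
import Mathlib

section
/- Let g be a finite-dimensional Lie algebra and let Ω be a graded differential algebra generated in degree 0 by the algebra A = Ω⁰ (i.e. generated by A as a graded differential algebra). Then any operation of g in Ω is the quotient, via the canonical surjective homomorphism of graded differential algebras Ω(A) → Ω, of a unique operation of g in the differential envelope Ω(A). -/
open scoped TensorProduct DirectSum

/-- A differential making an ℕ-graded algebra into a graded differential algebra:
`d` is homogeneous of degree `+1`, squares to zero, and is an antiderivation
(graded Leibniz rule). -/
structure IsGDA (K : Type) [Field K] (Ω : Type) [Ring Ω] [Algebra K Ω]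
    (𝒜 : ℕ → Submodule K Ω) (d : Ω →ₗ[K] Ω) : Prop where
  d_mem : ∀ (n : ℕ), ∀ a ∈ 𝒜 n, d a ∈ 𝒜 (n + 1)
  d_sq : ∀ a : Ω, d (d a) = 0
  leibniz : ∀ (n : ℕ) (a b : Ω), a ∈ 𝒜 n →
    d (a * b) = d a * b + ((-1 : K) ^ n) • (a * d b)

/-- An operation (in the sense of H. Cartan) of a Lie algebra `g` in a graded
differential algebra `Ω`: a linear family of degree `-1` antiderivations `i X`
satisfying the Cartan relation `[i X, L Y] = i ⁅X,Y⁆`, where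
`L Y = i Y ∘ d + d ∘ i Y`. -/
structure IsLieOperation (K : Type) [Field K] (g : Type) [LieRing g] [LieAlgebra K g]
    (Ω : Type) [Ring Ω] [Algebra K Ω] (𝒜 : ℕ → Submodule K Ω) (d : Ω →ₗ[K] Ω)
    (i : g →ₗ[K] Module.End K Ω) : Prop where
  i_mem : ∀ (X : g) (n : ℕ), ∀ a ∈ 𝒜 (n + 1), i X a ∈ 𝒜 n
  i_deg0 : ∀ (X : g), ∀ a ∈ 𝒜 0, i X a = 0
  antider : ∀ (X : g) (n : ℕ) (a b : Ω), a ∈ 𝒜 n →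
    i X (a * b) = i X a * b + ((-1 : K) ^ n) • (a * i X b)
  cartan : ∀ X Y : g,
    i X * ((d : Module.End K Ω) * i Y + i Y * (d : Module.End K Ω))
      - ((d : Module.End K Ω) * i Y + i Y * (d : Module.End K Ω)) * i X = i ⁅X, Y⁆

/-- The graded differential envelope `Ω_gr(A)` of an ℕ-graded algebra `A`
(for `A` trivially graded in degree `0` this is the universal differential
calculus, i.e. the differential envelope `Ω(A)`), encoded by its universal
property: a graded differential algebra together with a degree preserving
algebra homomorphism `ι : A → W` such that every degree preserving algebra
homomorphism from `A` to a graded differential algebra extends uniquely to a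
homomorphism of graded differential algebras on `W`. -/
structure GDEnvelope (K : Type) [Field K] (A : Type) [Ring A] [Algebra K A]
    (𝒜 : ℕ → Submodule K A) where
  W : Type
  ringW : Ring W
  algW : Algebra K W
  grading : ℕ → Submodule K W
  gradedW : GradedAlgebra grading
  d : W →ₗ[K] W
  isGDA : IsGDA K W grading d
  ι : A →ₐ[K] W
  ι_grading : ∀ (n : ℕ), ∀ a ∈ 𝒜 n, ι a ∈ grading n
  univ : ∀ (Ω : Type) (_ : Ring Ω) (_ : Algebra K Ω) (ℬ : ℕ → Submodule K Ω)
    (_ : GradedAlgebra ℬ) (d' : Ω →ₗ[K] Ω), IsGDA K Ω ℬ d' →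
    ∀ (α : A →ₐ[K] Ω), (∀ (n : ℕ), ∀ a ∈ 𝒜 n, α a ∈ ℬ n) →
    ∃! Φ : W →ₐ[K] Ω, (∀ (n : ℕ), ∀ w ∈ grading n, Φ w ∈ ℬ n) ∧
      (∀ w, Φ (d w) = d' (Φ w)) ∧ (∀ a, Φ (ι a) = α a)

attribute [instance] GDEnvelope.ringW GDEnvelope.algW GDEnvelope.gradedW

/-- The trivial grading on an algebra `A`, concentrating everything in
degree `0`; the differential envelope `Ω(A)` of an ungraded algebra `A` is the
graded differential envelope of `A` with this grading. -/
def trivGrading (K : Type) [Field K] (A : Type) [Ring A] [Algebra K A] :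
    ℕ → Submodule K A := fun n => if n = 0 then ⊤ else ⊥

section GradedTools

variable {K : Type*} [Field K]

theorem isInternal_of_projections {M N : Type*} [AddCommGroup M] [Module K M]
    [AddCommGroup N] [Module K N] (D : ℕ → Submodule K M) (p : ℕ → M →ₗ[K] N)
    (hinj : ∀ n, ∀ x ∈ D n, p n x = 0 → x = 0)
    (hzero : ∀ m n, n ≠ m → ∀ x ∈ D n, p m x = 0)
    (htop : ⨆ n, D n = ⊤) : DirectSum.IsInternal D := by
  rw [DirectSum.isInternal_submodule_iff_iSupIndep_and_iSup_eq_top]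
  refine ⟨fun n => ?_, htop⟩
  rw [Submodule.disjoint_def]
  intro x hx hx'
  have hle : ⨆ j, ⨆ (_ : j ≠ n), D j ≤ LinearMap.ker (p n) :=
    iSup₂_le fun j hj y hy => hzero n j hj y hy
  exact hinj n x hx (hle hx')

/-- A graded monoid structure on an internal direct sum gives a graded algebra. -/
@[reducible]
noncomputable def gradedAlgebraOfIsInternal {R : Type*} [Ring R] [Algebra K R]
    (D : ℕ → Submodule K R) [SetLike.GradedMonoid D] (h : DirectSum.IsInternal D) :
    GradedAlgebra D :=
  { h.chooseDecomposition with
    one_mem := SetLike.GradedOne.one_mem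
    mul_mem := SetLike.GradedMul.mul_mem }

variable {R : Type*} [Ring R] [Algebra K R] (𝒜 : ℕ → Submodule K R) [GradedAlgebra 𝒜]

theorem GradedAlgebra.induction_homogeneous {P : R → Prop} (zero : P 0)
    (homogeneous : ∀ n, ∀ a ∈ 𝒜 n, P a) (add : ∀ a b, P a → P b → P (a + b)) (a : R) : P a :=
  DirectSum.Decomposition.inductionOn 𝒜 zero (fun m => homogeneous _ m m.2) add a

/-- The parity automorphism of a graded algebra, multiplying `a` of degree `n` by `(-1) ^ n`. -/
noncomputable def paritySign : R →ₗ[K] R :=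
  DirectSum.toModule K ℕ R (fun n => ((-1 : K) ^ n) • (𝒜 n).subtype) ∘ₗ
    (DirectSum.decomposeLinearEquiv 𝒜).toLinearMap

theorem paritySign_of_mem {n : ℕ} {a : R} (ha : a ∈ 𝒜 n) :
    paritySign 𝒜 a = ((-1 : K) ^ n) • a := by
  rw [paritySign, LinearMap.comp_apply, LinearEquiv.coe_coe, DirectSum.decomposeLinearEquiv_apply,
    DirectSum.decompose_of_mem _ ha, ← DirectSum.lof_eq_of K, DirectSum.toModule_lof]
  rfl

theorem paritySign_of_mem_zero {a : R} (ha : a ∈ 𝒜 0) : paritySign 𝒜 a = a := by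
  simp [paritySign_of_mem 𝒜 ha]

theorem paritySign_one : paritySign 𝒜 (1 : R) = 1 :=
  paritySign_of_mem_zero 𝒜 SetLike.GradedOne.one_mem

theorem paritySign_mul (a b : R) :
    paritySign 𝒜 (a * b) = paritySign 𝒜 a * paritySign 𝒜 b := by
  induction a using GradedAlgebra.induction_homogeneous 𝒜 with
  | zero => simp
  | add a a' h h' => simp [add_mul, h, h']
  | homogeneous n a ha =>
    induction b using GradedAlgebra.induction_homogeneous 𝒜 with
    | zero => simp
    | add b b' h h' => simp [mul_add, h, h']
    | homogeneous m b hb =>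
      rw [paritySign_of_mem 𝒜 ha, paritySign_of_mem 𝒜 hb,
        paritySign_of_mem 𝒜 (SetLike.GradedMul.mul_mem ha hb)]
      simp [smul_smul, pow_add, mul_comm]

theorem paritySign_paritySign (a : R) : paritySign 𝒜 (paritySign 𝒜 a) = a := by
  induction a using GradedAlgebra.induction_homogeneous 𝒜 with
  | zero => simp
  | add a a' h h' => simp [h, h']
  | homogeneous n a ha =>
    rw [paritySign_of_mem 𝒜 ha, map_smul, paritySign_of_mem 𝒜 ha, smul_smul, ← mul_pow]
    simp

end GradedTools

section GDA

variable {K : Type} [Field K] {R : Type} [Ring R] [Algebra K R] {𝒜 : ℕ → Submodule K R}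
  {d : R →ₗ[K] R}

theorem IsGDA.map_one [GradedAlgebra 𝒜] (h : IsGDA K R 𝒜 d) : d 1 = 0 := by
  have := h.leibniz 0 1 1 SetLike.GradedOne.one_mem
  simpa using this

theorem IsGDA.map_mul [GradedAlgebra 𝒜] (h : IsGDA K R 𝒜 d) (a b : R) :
    d (a * b) = d a * b + paritySign 𝒜 a * d b := by
  induction a using GradedAlgebra.induction_homogeneous 𝒜 with
  | zero => simp
  | add a a' h h' => simp only [add_mul, map_add, h, h']; abel
  | homogeneous n a ha => rw [h.leibniz n a b ha, paritySign_of_mem 𝒜 ha, smul_mul_assoc]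

theorem IsGDA.paritySign_map [GradedAlgebra 𝒜] (h : IsGDA K R 𝒜 d) (a : R) :
    paritySign 𝒜 (d a) = -d (paritySign 𝒜 a) := by
  induction a using GradedAlgebra.induction_homogeneous 𝒜 with
  | zero => simp
  | add a a' h h' => simp only [map_add, h, h']; abel
  | homogeneous n a ha =>
    rw [paritySign_of_mem 𝒜 ha, paritySign_of_mem 𝒜 (h.d_mem n a ha), map_smul, pow_succ]
    simp

end GDA

section HomotopyExt

variable {K : Type} [Field K] {R : Type} [Ring R] [Algebra K R]

/-- The extension `R ⊕ ηR ⊕ θR` of a graded differential algebra by square-zero elements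
`η` of degree `0` and `θ = dη` of degree `1`. Homomorphisms of graded differential algebras
into it encode antiderivations of degree `-1`. -/
@[ext]
structure HomotopyExt (𝒜 : ℕ → Submodule K R) : Type where
  base : R
  eta : R
  theta : R

namespace HomotopyExt

variable (𝒜 : ℕ → Submodule K R)

/-- The coordinates of an element of `HomotopyExt 𝒜`. -/
def equivProd : HomotopyExt 𝒜 ≃ R × R × R where
  toFun x := (x.base, x.eta, x.theta)
  invFun x := ⟨x.1, x.2.1, x.2.2⟩
  left_inv _ := rfl
  right_inv _ := rfl

instance : AddCommGroup (HomotopyExt 𝒜) := (equivProd 𝒜).addCommGroup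

instance : Module K (HomotopyExt 𝒜) := (equivProd 𝒜).module K

variable {𝒜}

@[simp] theorem base_zero : (0 : HomotopyExt 𝒜).base = 0 := rfl
@[simp] theorem eta_zero : (0 : HomotopyExt 𝒜).eta = 0 := rfl
@[simp] theorem theta_zero : (0 : HomotopyExt 𝒜).theta = 0 := rfl
@[simp] theorem base_add (x y : HomotopyExt 𝒜) : (x + y).base = x.base + y.base := rfl
@[simp] theorem eta_add (x y : HomotopyExt 𝒜) : (x + y).eta = x.eta + y.eta := rfl
@[simp] theorem theta_add (x y : HomotopyExt 𝒜) : (x + y).theta = x.theta + y.theta := rfl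
@[simp] theorem base_smul (c : K) (x : HomotopyExt 𝒜) : (c • x).base = c • x.base := rfl
@[simp] theorem eta_smul (c : K) (x : HomotopyExt 𝒜) : (c • x).eta = c • x.eta := rfl
@[simp] theorem theta_smul (c : K) (x : HomotopyExt 𝒜) : (c • x).theta = c • x.theta := rfl

instance : One (HomotopyExt 𝒜) := ⟨⟨1, 0, 0⟩⟩

@[simp] theorem base_one : (1 : HomotopyExt 𝒜).base = 1 := rfl
@[simp] theorem eta_one : (1 : HomotopyExt 𝒜).eta = 0 := rfl
@[simp] theorem theta_one : (1 : HomotopyExt 𝒜).theta = 0 := rfl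

variable [GradedAlgebra 𝒜]

noncomputable instance : Mul (HomotopyExt 𝒜) :=
  ⟨fun x y => ⟨x.base * y.base, x.eta * y.base + x.base * y.eta,
    x.theta * y.base + paritySign 𝒜 x.base * y.theta⟩⟩

@[simp] theorem base_mul (x y : HomotopyExt 𝒜) : (x * y).base = x.base * y.base := rfl
@[simp] theorem eta_mul (x y : HomotopyExt 𝒜) :
    (x * y).eta = x.eta * y.base + x.base * y.eta := rfl
@[simp] theorem theta_mul (x y : HomotopyExt 𝒜) :
    (x * y).theta = x.theta * y.base + paritySign 𝒜 x.base * y.theta := rfl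

noncomputable instance : Ring (HomotopyExt 𝒜) :=
  { (inferInstance : AddCommGroup (HomotopyExt 𝒜)) with
    one_mul := fun x => by ext <;> simp [paritySign_one]
    mul_one := fun x => by ext <;> simp
    zero_mul := fun x => by ext <;> simp
    mul_zero := fun x => by ext <;> simp
    mul_assoc := fun x y z => by
      ext <;> simp [paritySign_mul, mul_add, add_mul, mul_assoc, add_assoc]
    left_distrib := fun x y z => by ext <;> simp [mul_add] <;> abel
    right_distrib := fun x y z => by ext <;> simp [add_mul] <;> abel }

noncomputable instance : Algebra K (HomotopyExt 𝒜) :=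
  Algebra.ofModule (fun c x y => by ext <;> simp) (fun c x y => by ext <;> simp)

variable (𝒜) in
/-- The projection onto the base. -/
noncomputable def baseHom : HomotopyExt 𝒜 →ₐ[K] R :=
  AlgHom.ofLinearMap ⟨⟨fun x : HomotopyExt 𝒜 => x.base, base_add⟩, base_smul⟩
    rfl (fun _ _ => rfl)

@[simp] theorem baseHom_apply (x : HomotopyExt 𝒜) : baseHom 𝒜 x = x.base := rfl

variable (𝒜) in
/-- The grading of `HomotopyExt 𝒜`, in which `η` has degree `0` and `θ` has degree `1`. -/
def grading (n : ℕ) : Submodule K (HomotopyExt 𝒜) where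
  carrier := {x | x.base ∈ 𝒜 n ∧ x.eta ∈ 𝒜 n ∧
    (n = 0 → x.theta = 0) ∧ ∀ m, n = m + 1 → x.theta ∈ 𝒜 m}
  add_mem' := fun hx hy => ⟨add_mem hx.1 hy.1, add_mem hx.2.1 hy.2.1,
    fun h => by simp [hx.2.2.1 h, hy.2.2.1 h],
    fun m h => add_mem (hx.2.2.2 m h) (hy.2.2.2 m h)⟩
  zero_mem' := ⟨zero_mem _, zero_mem _, fun _ => rfl, fun _ _ => zero_mem _⟩
  smul_mem' := fun c x hx => ⟨Submodule.smul_mem _ c hx.1, Submodule.smul_mem _ c hx.2.1,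
    fun h => by simp [hx.2.2.1 h], fun m h => Submodule.smul_mem _ c (hx.2.2.2 m h)⟩

theorem mem_grading {n : ℕ} {x : HomotopyExt 𝒜} : x ∈ grading 𝒜 n ↔
    x.base ∈ 𝒜 n ∧ x.eta ∈ 𝒜 n ∧
      (n = 0 → x.theta = 0) ∧ ∀ m, n = m + 1 → x.theta ∈ 𝒜 m := Iff.rfl

theorem mem_grading_zero {x : HomotopyExt 𝒜} : x ∈ grading 𝒜 0 ↔
    x.base ∈ 𝒜 0 ∧ x.eta ∈ 𝒜 0 ∧ x.theta = 0 := by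
  simp [mem_grading]

theorem mem_grading_succ {n : ℕ} {x : HomotopyExt 𝒜} : x ∈ grading 𝒜 (n + 1) ↔
    x.base ∈ 𝒜 (n + 1) ∧ x.eta ∈ 𝒜 (n + 1) ∧ x.theta ∈ 𝒜 n := by
  simp [mem_grading]

theorem paritySign_mem {n m : ℕ} {a : R} (ha : a ∈ 𝒜 n) (h : n = m) :
    paritySign 𝒜 a ∈ 𝒜 m := by
  subst h
  rw [paritySign_of_mem 𝒜 ha]
  exact Submodule.smul_mem _ _ ha

instance : SetLike.GradedMonoid (grading 𝒜) where
  one_mem := mem_grading_zero.2 ⟨SetLike.GradedOne.one_mem, zero_mem _, rfl⟩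
  mul_mem := by
    rintro n m x y ⟨hx1, hx2, hx3, hx4⟩ ⟨hy1, hy2, hy3, hy4⟩
    refine ⟨SetLike.GradedMul.mul_mem hx1 hy1, add_mem (SetLike.GradedMul.mul_mem hx2 hy1)
      (SetLike.GradedMul.mul_mem hx1 hy2), fun h => ?_, fun k h => ?_⟩
    · simp [hx3 (by omega), hy3 (by omega)]
    · refine add_mem ?_ ?_
      · rcases n with _ | n
        · simp [hx3 rfl]
        · obtain rfl : k = n + m := by omega
          exact SetLike.GradedMul.mul_mem (hx4 n rfl) hy1
      · rcases m with _ | m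
        · simp [hy3 rfl]
        · obtain rfl : k = n + m := by omega
          exact SetLike.GradedMul.mul_mem (paritySign_mem hx1 rfl) (hy4 m rfl)

variable (𝒜) in
/-- The coordinates of the homogeneous component of degree `n`. -/
noncomputable def component (n : ℕ) : HomotopyExt 𝒜 →ₗ[K] R × R × R where
  toFun x := (GradedAlgebra.proj 𝒜 n x.base, GradedAlgebra.proj 𝒜 n x.eta,
    n.casesOn 0 fun m => GradedAlgebra.proj 𝒜 m x.theta)
  map_add' x y := by cases n <;> simp
  map_smul' c x := by cases n <;> simp

theorem isInternal_grading : DirectSum.IsInternal (grading 𝒜) := by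
  refine isInternal_of_projections _ (component 𝒜) ?_ ?_ ?_
  · rintro (_ | n) x hx h
    · rw [mem_grading_zero] at hx
      simp only [component, LinearMap.coe_mk, AddHom.coe_mk, GradedAlgebra.proj_apply,
        DirectSum.decompose_of_mem_same _ hx.1, DirectSum.decompose_of_mem_same _ hx.2.1,
        Prod.mk_eq_zero] at h
      exact HomotopyExt.ext h.1 h.2.1 hx.2.2
    · rw [mem_grading_succ] at hx
      simp only [component, LinearMap.coe_mk, AddHom.coe_mk, GradedAlgebra.proj_apply,
        DirectSum.decompose_of_mem_same _ hx.1, DirectSum.decompose_of_mem_same _ hx.2.1,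
        DirectSum.decompose_of_mem_same _ hx.2.2, Prod.mk_eq_zero] at h
      exact HomotopyExt.ext h.1 h.2.1 h.2.2
  · rintro m n hne x ⟨h1, h2, h3, h4⟩
    simp only [component, LinearMap.coe_mk, AddHom.coe_mk, GradedAlgebra.proj_apply,
      DirectSum.decompose_of_mem_ne _ h1 hne, DirectSum.decompose_of_mem_ne _ h2 hne,
      Prod.mk_eq_zero, true_and]
    rcases m with _ | m
    · rfl
    · rcases n with _ | n
      · simp [h3 rfl]
      · exact DirectSum.decompose_of_mem_ne _ (h4 n rfl) (by omega)
  · rw [eq_top_iff]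
    rintro ⟨a, l, m⟩ -
    have ha : (⟨a, 0, 0⟩ : HomotopyExt 𝒜) ∈ ⨆ n, grading 𝒜 n := by
      induction a using GradedAlgebra.induction_homogeneous 𝒜 with
      | zero => exact zero_mem _
      | add a a' h h' => convert add_mem h h' using 1; ext <;> simp
      | homogeneous n a ha =>
        exact Submodule.mem_iSup_of_mem n (mem_grading.2 (by simp [ha]))
    have hl : (⟨0, l, 0⟩ : HomotopyExt 𝒜) ∈ ⨆ n, grading 𝒜 n := by
      induction l using GradedAlgebra.induction_homogeneous 𝒜 with
      | zero => exact zero_mem _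
      | add a a' h h' => convert add_mem h h' using 1; ext <;> simp
      | homogeneous n a ha =>
        exact Submodule.mem_iSup_of_mem n (mem_grading.2 (by simp [ha]))
    have hm : (⟨0, 0, m⟩ : HomotopyExt 𝒜) ∈ ⨆ n, grading 𝒜 n := by
      induction m using GradedAlgebra.induction_homogeneous 𝒜 with
      | zero => exact zero_mem _
      | add a a' h h' => convert add_mem h h' using 1; ext <;> simp
      | homogeneous n a ha =>
        exact Submodule.mem_iSup_of_mem (n + 1) (mem_grading_succ.2 (by simp [ha]))
    convert add_mem (add_mem ha hl) hm using 1
    ext <;> simp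

noncomputable instance : GradedAlgebra (grading 𝒜) :=
  gradedAlgebraOfIsInternal _ isInternal_grading

variable (𝒜) in
/-- The differential of `HomotopyExt 𝒜`, determined by `d` and `dη = θ`. -/
def diff (d : R →ₗ[K] R) : HomotopyExt 𝒜 →ₗ[K] HomotopyExt 𝒜 where
  toFun x := ⟨d x.base, d x.eta, x.eta - d x.theta⟩
  map_add' x y := by ext <;> simp; abel
  map_smul' c x := by ext <;> simp [smul_sub]

section diff

variable (d : R →ₗ[K] R) (x : HomotopyExt 𝒜)

@[simp] theorem base_diff : (diff 𝒜 d x).base = d x.base := rfl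
@[simp] theorem eta_diff : (diff 𝒜 d x).eta = d x.eta := rfl
@[simp] theorem theta_diff : (diff 𝒜 d x).theta = x.eta - d x.theta := rfl

end diff

theorem isGDA_diff {d : R →ₗ[K] R} (h : IsGDA K R 𝒜 d) :
    IsGDA K (HomotopyExt 𝒜) (grading 𝒜) (diff 𝒜 d) where
  d_mem := by
    rintro n x ⟨h1, h2, h3, h4⟩
    refine mem_grading_succ.2 ⟨h.d_mem n _ h1, h.d_mem n _ h2, sub_mem h2 ?_⟩
    rcases n with _ | n
    · simp [h3 rfl]
    · exact h.d_mem n _ (h4 n rfl)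
  d_sq x := by ext <;> simp [h.d_sq]
  leibniz := by
    rintro n x y ⟨h1, h2, h3, h4⟩
    ext
    · simp [h.leibniz n _ _ h1]
    · simp only [eta_diff, eta_mul, eta_add, eta_smul, base_diff, map_add,
        h.leibniz n _ _ h1, h.leibniz n _ _ h2, smul_add]
      abel
    · have key : d (x.theta * y.base) =
          d x.theta * y.base - ((-1 : K) ^ n) • (x.theta * d y.base) := by
        rcases n with _ | n
        · simp [h3 rfl]
        · rw [h.leibniz n _ _ (h4 n rfl), pow_succ]
          simp
      have hs : ((-1 : K) ^ n) • paritySign 𝒜 x.base = x.base := by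
        rw [← map_smul, ← paritySign_of_mem 𝒜 h1, paritySign_paritySign]
      have hs' : ∀ z, ((-1 : K) ^ n) • (paritySign 𝒜 x.base * z) = x.base * z := fun z => by
        rw [← smul_mul_assoc, hs]
      simp only [theta_diff, theta_mul, theta_add, theta_smul, base_diff, eta_mul, map_add,
        key, h.map_mul (paritySign 𝒜 x.base), paritySign_paritySign, smul_add, smul_sub, hs',
        h.paritySign_map, mul_sub, sub_mul, neg_mul]
      abel

end HomotopyExt

end HomotopyExt

section Antiderivation

variable {K : Type} [Field K] {R : Type} [Ring R] [Algebra K R] {S : Type} [Ring S]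
  [Algebra K S]

/-- Antiderivations of degree `-1` along a homomorphism `π` of graded algebras. -/
structure IsContraction (𝒜 : ℕ → Submodule K R) (ℬ : ℕ → Submodule K S) [GradedAlgebra ℬ]
    (π : R →ₐ[K] S) (f : R →ₗ[K] S) : Prop where
  map_mem : ∀ n, ∀ a ∈ 𝒜 (n + 1), f a ∈ ℬ n
  map_zero_deg : ∀ a ∈ 𝒜 0, f a = 0
  map_mul : ∀ a b, f (a * b) = f a * π b + paritySign ℬ (π a) * f b

variable {𝒜 : ℕ → Submodule K R} {ℬ : ℕ → Submodule K S} [GradedAlgebra ℬ]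

namespace IsContraction

variable {π : R →ₐ[K] S} {f g : R →ₗ[K] S} {d : R →ₗ[K] R} {d' : S →ₗ[K] S}

theorem cartan_mem (hd : IsGDA K R 𝒜 d) (hd' : IsGDA K S ℬ d')
    (hf : IsContraction 𝒜 ℬ π f) {n : ℕ} {a : R} (ha : a ∈ 𝒜 n) :
    d' (f a) + f (d a) ∈ ℬ n := by
  refine add_mem ?_ (hf.map_mem n _ (hd.d_mem n a ha))
  rcases n with _ | n
  · simp [hf.map_zero_deg a ha]
  · exact hd'.d_mem n _ (hf.map_mem n a ha)

theorem add (hf : IsContraction 𝒜 ℬ π f) (hg : IsContraction 𝒜 ℬ π g) :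
    IsContraction 𝒜 ℬ π (f + g) where
  map_mem n a ha := add_mem (hf.map_mem n a ha) (hg.map_mem n a ha)
  map_zero_deg a ha := by simp [hf.map_zero_deg a ha, hg.map_zero_deg a ha]
  map_mul a b := by
    simp only [LinearMap.add_apply, hf.map_mul, hg.map_mul, add_mul, mul_add]
    abel

theorem smul (c : K) (hf : IsContraction 𝒜 ℬ π f) : IsContraction 𝒜 ℬ π (c • f) where
  map_mem n a ha := Submodule.smul_mem _ c (hf.map_mem n a ha)
  map_zero_deg a ha := by simp [hf.map_zero_deg a ha]
  map_mul a b := by simp [hf.map_mul]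

theorem hom_comp {f : S →ₗ[K] S} (hπ : ∀ n, ∀ a ∈ 𝒜 n, π a ∈ ℬ n)
    (hf : IsContraction ℬ ℬ (AlgHom.id K S) f) :
    IsContraction 𝒜 ℬ π (f ∘ₗ π.toLinearMap) where
  map_mem n a ha := hf.map_mem n _ (hπ _ a ha)
  map_zero_deg a ha := hf.map_zero_deg _ (hπ _ a ha)
  map_mul a b := by simp [hf.map_mul]

end IsContraction

variable [GradedAlgebra 𝒜]

theorem map_paritySign {π : R →ₐ[K] S} (hπ : ∀ n, ∀ a ∈ 𝒜 n, π a ∈ ℬ n) (a : R) :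
    π (paritySign 𝒜 a) = paritySign ℬ (π a) := by
  induction a using GradedAlgebra.induction_homogeneous 𝒜 with
  | zero => simp
  | add a a' h h' => simp [h, h']
  | homogeneous n a ha =>
    rw [paritySign_of_mem 𝒜 ha, paritySign_of_mem ℬ (hπ n a ha), map_smul]

namespace IsContraction

variable {π : R →ₐ[K] S} {f : R →ₗ[K] S} {d : R →ₗ[K] R} {d' : S →ₗ[K] S}

theorem map_paritySign (hf : IsContraction 𝒜 ℬ π f) (a : R) :
    f (paritySign 𝒜 a) = -paritySign ℬ (f a) := by
  induction a using GradedAlgebra.induction_homogeneous 𝒜 with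
  | zero => simp
  | add a a' h h' => simp only [map_add, h, h']; abel
  | homogeneous n a ha =>
    rw [paritySign_of_mem 𝒜 ha, map_smul]
    rcases n with _ | n
    · simp [hf.map_zero_deg a ha]
    · rw [paritySign_of_mem ℬ (hf.map_mem n a ha), pow_succ]
      simp

theorem map_one (hf : IsContraction 𝒜 ℬ π f) : f 1 = 0 :=
  hf.map_zero_deg 1 SetLike.GradedOne.one_mem

theorem cartan_mul (hd : IsGDA K R 𝒜 d) (hd' : IsGDA K S ℬ d')
    (hπ : ∀ n, ∀ a ∈ 𝒜 n, π a ∈ ℬ n) (hπd : ∀ a, π (d a) = d' (π a))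
    (hf : IsContraction 𝒜 ℬ π f) (a b : R) :
    d' (f (a * b)) + f (d (a * b)) =
      (d' (f a) + f (d a)) * π b + π a * (d' (f b) + f (d b)) := by
  simp only [hf.map_mul, hd.map_mul, hd'.map_mul, map_add, hπd, hf.map_paritySign,
    _root_.map_paritySign hπ, hd'.paritySign_map, paritySign_paritySign, mul_add, add_mul,
    neg_mul]
  abel

/-- The homomorphism `a ↦ π a + η L a + θ f a` encoding a contraction `f`, where
`L = d f + f d`. -/
noncomputable def toHomotopyExt (hd : IsGDA K R 𝒜 d) (hd' : IsGDA K S ℬ d')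
    (hπ : ∀ n, ∀ a ∈ 𝒜 n, π a ∈ ℬ n) (hπd : ∀ a, π (d a) = d' (π a))
    (hf : IsContraction 𝒜 ℬ π f) : R →ₐ[K] HomotopyExt ℬ :=
  AlgHom.ofLinearMap
    { toFun := fun a => ⟨π a, d' (f a) + f (d a), f a⟩
      map_add' := fun a b => by ext <;> simp; abel
      map_smul' := fun c a => by ext <;> simp }
    (by ext <;> simp [hf.map_one, hd.map_one])
    (fun a b => by
      ext
      · simp
      · simpa using hf.cartan_mul hd hd' hπ hπd a b
      · simpa using hf.map_mul a b)

theorem comp_hom {f : R →ₗ[K] R} (hπ : ∀ n, ∀ a ∈ 𝒜 n, π a ∈ ℬ n)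
    (hf : IsContraction 𝒜 𝒜 (AlgHom.id K R) f) :
    IsContraction 𝒜 ℬ π (π.toLinearMap ∘ₗ f) where
  map_mem n a ha := hπ n _ (hf.map_mem n a ha)
  map_zero_deg a ha := by simp [hf.map_zero_deg a ha]
  map_mul a b := by simp [hf.map_mul, _root_.map_paritySign hπ]

/-- The commutator of a contraction with a Lie derivative is a contraction. -/
theorem cartan_bracket {f g : Module.End K R} (hd : IsGDA K R 𝒜 d)
    (hf : IsContraction 𝒜 𝒜 (AlgHom.id K R) f) (hg : IsContraction 𝒜 𝒜 (AlgHom.id K R) g) :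
    IsContraction 𝒜 𝒜 (AlgHom.id K R)
      (f * ((d : Module.End K R) * g + g * (d : Module.End K R)) -
        ((d : Module.End K R) * g + g * (d : Module.End K R)) * f) where
  map_mem n a ha := sub_mem (hf.map_mem n _ (hg.cartan_mem hd hd ha))
    (hg.cartan_mem hd hd (hf.map_mem n a ha))
  map_zero_deg a ha := by
    have h := hf.map_zero_deg _ (hg.cartan_mem hd hd ha)
    simp only [LinearMap.sub_apply, Module.End.mul_apply, LinearMap.add_apply, h,
      hf.map_zero_deg a ha, map_zero]
    simp
  map_mul a b := by
    have hL := hg.cartan_mul hd hd (fun _ _ h => h) (fun _ => rfl)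
    have hc : ∀ x, d (g (paritySign 𝒜 x)) + g (d (paritySign 𝒜 x)) =
        paritySign 𝒜 (d (g x) + g (d x)) := fun x => by
      have := hd.paritySign_map x
      rw [hg.map_paritySign, ← neg_eq_iff_eq_neg.2 this, map_neg, map_neg, hg.map_paritySign,
        map_add, hd.paritySign_map]
      simp
    simp only [AlgHom.id_apply] at hL
    simp only [LinearMap.sub_apply, Module.End.mul_apply, LinearMap.add_apply, AlgHom.id_apply]
    rw [hL, map_add, hf.map_mul, hf.map_mul, hf.map_mul]
    have h2 : d (g (f a * b + paritySign 𝒜 a * f b)) + g (d (f a * b + paritySign 𝒜 a * f b)) =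
        (d (g (f a * b)) + g (d (f a * b))) +
          (d (g (paritySign 𝒜 a * f b)) + g (d (paritySign 𝒜 a * f b))) := by
      simp only [map_add]; abel
    simp only [AlgHom.id_apply]
    rw [h2, hL, hL, hc]
    noncomm_ring

end IsContraction

theorem IsLieOperation.isContraction {g : Type} [LieRing g] [LieAlgebra K g] {d : R →ₗ[K] R}
    {i : g →ₗ[K] Module.End K R} (hi : IsLieOperation K g R 𝒜 d i) (X : g) :
    IsContraction 𝒜 𝒜 (AlgHom.id K R) (i X) where
  map_mem := hi.i_mem X
  map_zero_deg := hi.i_deg0 X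
  map_mul a b := by
    induction a using GradedAlgebra.induction_homogeneous 𝒜 with
    | zero => simp
    | add a a' h h' =>
      simp only [add_mul, map_add, h, h']
      abel
    | homogeneous n a ha =>
      rw [hi.antider X n a b ha, AlgHom.id_apply, AlgHom.id_apply, paritySign_of_mem 𝒜 ha,
        smul_mul_assoc]

theorem IsContraction.antider {f : R →ₗ[K] R} (hf : IsContraction 𝒜 𝒜 (AlgHom.id K R) f)
    {n : ℕ} {a : R} (ha : a ∈ 𝒜 n) (b : R) :
    f (a * b) = f a * b + ((-1 : K) ^ n) • (a * f b) := by
  rw [hf.map_mul, AlgHom.id_apply, AlgHom.id_apply, paritySign_of_mem 𝒜 ha, smul_mul_assoc]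

end Antiderivation

namespace GDEnvelope

variable {K : Type} [Field K] {A : Type} [Ring A] [Algebra K A]

theorem hom_ext {𝒜 : ℕ → Submodule K A} (E : GDEnvelope K A 𝒜)
    {S : Type} [Ring S] [Algebra K S] {ℬ : ℕ → Submodule K S} [hℬ : GradedAlgebra ℬ]
    {d : S →ₗ[K] S} (hd : IsGDA K S ℬ d) {Φ Ψ : E.W →ₐ[K] S}
    (hΦ : ∀ n, ∀ w ∈ E.grading n, Φ w ∈ ℬ n) (hΦd : ∀ w, Φ (E.d w) = d (Φ w))
    (hΨ : ∀ n, ∀ w ∈ E.grading n, Ψ w ∈ ℬ n) (hΨd : ∀ w, Ψ (E.d w) = d (Ψ w))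
    (h : ∀ a, Φ (E.ι a) = Ψ (E.ι a)) : Φ = Ψ :=
  (E.univ S _ _ ℬ hℬ d hd (Φ.comp E.ι) fun n a ha => hΦ n _ (E.ι_grading n a ha)).unique
    ⟨hΦ, hΦd, fun _ => rfl⟩ ⟨hΨ, hΨd, fun a => (h a).symm⟩

variable (E : GDEnvelope K A (trivGrading K A))

theorem ι_mem_zero (a : A) : E.ι a ∈ E.grading 0 :=
  E.ι_grading 0 a (by simp [trivGrading])

theorem map_mem_of_trivGrading {S : Type} [Ring S] [Algebra K S] {ℬ : ℕ → Submodule K S}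
    {α : A →ₐ[K] S} (h : ∀ a, α a ∈ ℬ 0) (n : ℕ) (a : A) (ha : a ∈ trivGrading K A n) :
    α a ∈ ℬ n := by
  rcases n with _ | n
  · exact h a
  · have : a = 0 := by simpa [trivGrading] using ha
    simp [this]

/-- A contraction on the differential envelope is determined by its values on exact
one-forms. -/
theorem contraction_ext {S : Type} [Ring S] [Algebra K S] {ℬ : ℕ → Submodule K S}
    [GradedAlgebra ℬ] {d : S →ₗ[K] S} (hd : IsGDA K S ℬ d) {π : E.W →ₐ[K] S}
    (hπ : ∀ n, ∀ w ∈ E.grading n, π w ∈ ℬ n) (hπd : ∀ w, π (E.d w) = d (π w))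
    {f g : E.W →ₗ[K] S} (hf : IsContraction E.grading ℬ π f)
    (hg : IsContraction E.grading ℬ π g) (h : ∀ a, f (E.d (E.ι a)) = g (E.d (E.ι a))) :
    f = g := by
  have mem : ∀ {f : E.W →ₗ[K] S} (hf : IsContraction E.grading ℬ π f) (n : ℕ),
      ∀ w ∈ E.grading n,
        hf.toHomotopyExt E.isGDA hd hπ hπd w ∈ HomotopyExt.grading ℬ n := by
    rintro f hf n w hw
    refine ⟨hπ n w hw, hf.cartan_mem E.isGDA hd hw, ?_, ?_⟩
    · rintro rfl
      exact hf.map_zero_deg w hw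
    · rintro m rfl
      exact hf.map_mem m w hw
  have comm : ∀ {f : E.W →ₗ[K] S} (hf : IsContraction E.grading ℬ π f) (w : E.W),
      hf.toHomotopyExt E.isGDA hd hπ hπd (E.d w) =
        HomotopyExt.diff ℬ d (hf.toHomotopyExt E.isGDA hd hπ hπd w) := fun hf w => by
    ext <;> simp [IsContraction.toHomotopyExt, hπd, E.isGDA.d_sq, hd.d_sq]
  have key := E.hom_ext (HomotopyExt.isGDA_diff hd) (mem hf) (comm hf) (mem hg) (comm hg)
    fun a => by
      ext
      · rfl
      · simp [IsContraction.toHomotopyExt, h, hf.map_zero_deg _ (E.ι_mem_zero a),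
          hg.map_zero_deg _ (E.ι_mem_zero a)]
      · exact (hf.map_zero_deg _ (E.ι_mem_zero a)).trans
          (hg.map_zero_deg _ (E.ι_mem_zero a)).symm
  ext w
  exact congrArg HomotopyExt.theta (DFunLike.congr_fun key w)

/-- Derivations of degree `0` on `A` extend to contractions on the differential envelope. -/
theorem exists_contraction (D : A →ₗ[K] E.W) (hD0 : ∀ a, D a ∈ E.grading 0)
    (hD : ∀ a b, D (a * b) = D a * E.ι b + E.ι a * D b) :
    ∃ f : E.W →ₗ[K] E.W, IsContraction E.grading E.grading (AlgHom.id K E.W) f ∧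
      ∀ a, f (E.d (E.ι a)) = D a := by
  have hD1 : D 1 = 0 := by simpa using hD 1 1
  let α : A →ₐ[K] HomotopyExt E.grading := AlgHom.ofLinearMap
    { toFun := fun a => ⟨E.ι a, D a, 0⟩
      map_add' := fun a b => by ext <;> simp
      map_smul' := fun c a => by ext <;> simp }
    (by ext <;> simp [hD1]) (fun a b => by ext <;> simp [hD])
  obtain ⟨Φ, ⟨hΦ, hΦd, hΦι⟩, -⟩ := E.univ _ _ _ (HomotopyExt.grading E.grading) inferInstance _
    (HomotopyExt.isGDA_diff E.isGDA) α (map_mem_of_trivGrading fun a =>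
      HomotopyExt.mem_grading_zero.2 ⟨E.ι_mem_zero a, hD0 a, rfl⟩)
  have hbase : ∀ w, (Φ w).base = w := DFunLike.congr_fun <|
    E.hom_ext (Φ := (HomotopyExt.baseHom E.grading).comp Φ) (Ψ := AlgHom.id K E.W) E.isGDA
      (fun n w hw => (hΦ n w hw).1) (fun w => by simp [hΦd]) (fun _ _ h => h) (fun _ => rfl)
      (fun a => by simp [hΦι, α])
  refine ⟨{ toFun := fun w => (Φ w).theta, map_add' := fun v w => by simp,
            map_smul' := fun c w => by simp }, ⟨?_, ?_, ?_⟩, ?_⟩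
  · exact fun n w hw => (HomotopyExt.mem_grading_succ.1 (hΦ _ w hw)).2.2
  · exact fun w hw => (HomotopyExt.mem_grading_zero.1 (hΦ _ w hw)).2.2
  · intro a b
    simp [hbase]
  · intro a
    simp [hΦd, hΦι, α]

/-- The subalgebra of elements whose degree `0` component comes from `A`. -/
noncomputable def zeroComponentInRange : Subalgebra K E.W where
  carrier := {w | GradedAlgebra.proj E.grading 0 w ∈ E.ι.range}
  add_mem' := fun {x y} hx hy => by
    change GradedAlgebra.proj E.grading 0 (x + y) ∈ E.ι.range
    rw [map_add]
    exact add_mem hx hy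
  mul_mem' := fun {x y} hx hy => by
    have : GradedAlgebra.proj E.grading 0 (x * y) =
        GradedAlgebra.proj E.grading 0 x * GradedAlgebra.proj E.grading 0 y :=
      map_mul (GradedRing.projZeroRingHom E.grading) x y
    change GradedAlgebra.proj E.grading 0 (x * y) ∈ E.ι.range
    rw [this]
    exact mul_mem hx hy
  algebraMap_mem' := fun c => ⟨algebraMap K A c, (E.ι.commutes c).trans
    (DirectSum.decompose_of_mem_same _ (SetLike.algebraMap_mem_graded E.grading c)).symm⟩

theorem mem_zeroComponentInRange {w : E.W} :
    w ∈ E.zeroComponentInRange ↔ GradedAlgebra.proj E.grading 0 w ∈ E.ι.range := Iff.rfl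

theorem mem_zeroComponentInRange_of_mem_succ {n : ℕ} {w : E.W} (hw : w ∈ E.grading (n + 1)) :
    w ∈ E.zeroComponentInRange := by
  rw [mem_zeroComponentInRange, GradedAlgebra.proj_apply,
    DirectSum.decompose_of_mem_ne _ hw (by omega)]
  exact zero_mem _

theorem d_mem_zeroComponentInRange (w : E.W) : E.d w ∈ E.zeroComponentInRange := by
  induction w using GradedAlgebra.induction_homogeneous E.grading with
  | zero => simp
  | add a b h h' => rw [map_add]; exact add_mem h h'
  | homogeneous n a ha =>
    exact E.mem_zeroComponentInRange_of_mem_succ (E.isGDA.d_mem n a ha)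

theorem proj_mem_zeroComponentInRange (n : ℕ) {w : E.W} (hw : w ∈ E.zeroComponentInRange) :
    (DirectSum.decompose E.grading w n : E.W) ∈ E.zeroComponentInRange := by
  rcases n with _ | n
  · rw [mem_zeroComponentInRange, GradedAlgebra.proj_apply, DirectSum.decompose_coe,
      DirectSum.of_eq_same]
    exact hw
  · exact E.mem_zeroComponentInRange_of_mem_succ (SetLike.coe_mem _)

/-- The grading induced on `zeroComponentInRange`. -/
noncomputable def subGrading (n : ℕ) : Submodule K E.zeroComponentInRange :=
  (E.grading n).comap E.zeroComponentInRange.val.toLinearMap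

theorem mem_subGrading {n : ℕ} {w : E.zeroComponentInRange} :
    w ∈ E.subGrading n ↔ (w : E.W) ∈ E.grading n := Iff.rfl

instance : SetLike.GradedMonoid E.subGrading where
  one_mem := SetLike.GradedOne.one_mem (A := E.grading)
  mul_mem _ _ _ _ hx hy := SetLike.GradedMul.mul_mem (A := E.grading) hx hy

theorem isInternal_subGrading : DirectSum.IsInternal E.subGrading := by
  classical
  refine isInternal_of_projections _
    (fun n => GradedAlgebra.proj E.grading n ∘ₗ E.zeroComponentInRange.val.toLinearMap)
    (fun n x hx h => ?_) (fun m n hne x hx => ?_) ?_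
  · apply Subtype.ext
    simpa [DirectSum.decompose_of_mem_same _ (E.mem_subGrading.1 hx)] using h
  · simp [DirectSum.decompose_of_mem_ne _ (E.mem_subGrading.1 hx) hne]
  · rw [eq_top_iff]
    rintro x -
    have hx : x = ∑ n ∈ (DirectSum.decompose E.grading (x : E.W)).support,
        (⟨_, E.proj_mem_zeroComponentInRange n x.2⟩ : E.zeroComponentInRange) := by
      apply Subtype.ext
      simp only [AddSubmonoidClass.coe_finsetSum, DirectSum.sum_support_decompose]
    rw [hx]
    exact sum_mem fun n _ => Submodule.mem_iSup_of_mem n (E.mem_subGrading.2 (SetLike.coe_mem _))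

/-- The differential envelope of `A` coincides with `A` in degree `0`. -/
theorem exists_ι_eq {w : E.W} (hw : w ∈ E.grading 0) : ∃ a, E.ι a = w := by
  let dS : E.zeroComponentInRange →ₗ[K] E.zeroComponentInRange :=
    (E.d ∘ₗ E.zeroComponentInRange.val.toLinearMap).codRestrict
      (Subalgebra.toSubmodule E.zeroComponentInRange) fun x => E.d_mem_zeroComponentInRange x
  have hdS : IsGDA K E.zeroComponentInRange E.subGrading dS :=
    { d_mem := fun n a ha => E.isGDA.d_mem n a ha
      d_sq := fun a => Subtype.ext (E.isGDA.d_sq a)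
      leibniz := fun n a b ha => Subtype.ext (E.isGDA.leibniz n a b ha) }
  let α : A →ₐ[K] E.zeroComponentInRange := E.ι.codRestrict _ fun a => by
    rw [mem_zeroComponentInRange, GradedAlgebra.proj_apply,
      DirectSum.decompose_of_mem_same _ (E.ι_mem_zero a)]
    exact ⟨a, rfl⟩
  obtain ⟨Φ, ⟨hΦ, hΦd, hΦι⟩, -⟩ := E.univ _ _ _ E.subGrading
    (gradedAlgebraOfIsInternal _ E.isInternal_subGrading) dS hdS α
    (map_mem_of_trivGrading fun a => E.ι_mem_zero a)
  have hid : ∀ w, (Φ w : E.W) = w := DFunLike.congr_fun <|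
    E.hom_ext (Φ := E.zeroComponentInRange.val.comp Φ) (Ψ := AlgHom.id K E.W) E.isGDA hΦ
      (fun w => congrArg Subtype.val (hΦd w)) (fun _ _ h => h) (fun _ => rfl)
      (fun a => congrArg Subtype.val (hΦι a))
  have h := (Φ w).2
  rw [hid, mem_zeroComponentInRange, GradedAlgebra.proj_apply,
    DirectSum.decompose_of_mem_same _ hw] at h
  exact h

/-- A contraction on the differential envelope is determined by its projection along a
homomorphism that is injective on `A`. -/
theorem contraction_ext_of_comp {S : Type} [Ring S] [Algebra K S] (π : E.W →ₐ[K] S)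
    (hinj : Function.Injective fun a => π (E.ι a)) {f g : E.W →ₗ[K] E.W}
    (hf : IsContraction E.grading E.grading (AlgHom.id K E.W) f)
    (hg : IsContraction E.grading E.grading (AlgHom.id K E.W) g)
    (h : ∀ w, π (f w) = π (g w)) : f = g := by
  refine E.contraction_ext E.isGDA (fun _ _ h => h) (fun _ => rfl) hf hg fun a => ?_
  have hda := E.isGDA.d_mem 0 _ (E.ι_mem_zero a)
  obtain ⟨b, hb⟩ := E.exists_ι_eq (hf.map_mem 0 _ hda)
  obtain ⟨c, hc⟩ := E.exists_ι_eq (hg.map_mem 0 _ hda)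
  have hbc := h (E.d (E.ι a))
  rw [← hb, ← hc] at hbc ⊢
  rw [hinj hbc]

/-- Contractions lift to the differential envelope. -/
theorem exists_lift_contraction {S : Type} [Ring S] [Algebra K S] {ℬ : ℕ → Submodule K S}
    [GradedAlgebra ℬ] {d : S →ₗ[K] S} (hd : IsGDA K S ℬ d) {φ : A →ₐ[K] S}
    (hφinj : Function.Injective φ) (hφrange : LinearMap.range φ.toLinearMap = ℬ 0)
    {π : E.W →ₐ[K] S} (hπ : ∀ n, ∀ w ∈ E.grading n, π w ∈ ℬ n)
    (hπd : ∀ w, π (E.d w) = d (π w)) (hπι : ∀ a, π (E.ι a) = φ a) {f : S →ₗ[K] S}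
    (hf : IsContraction ℬ ℬ (AlgHom.id K S) f) :
    ∃ F : E.W →ₗ[K] E.W, IsContraction E.grading E.grading (AlgHom.id K E.W) F ∧
      ∀ w, π (F w) = f (π w) := by
  have hφ0 : ∀ a, φ a ∈ ℬ 0 := fun a => hφrange ▸ LinearMap.mem_range_self φ.toLinearMap a
  let e := LinearEquiv.ofInjective φ.toLinearMap hφinj
  let δ : A →ₗ[K] A := e.symm.toLinearMap ∘ₗ
    (f ∘ₗ d ∘ₗ φ.toLinearMap).codRestrict (LinearMap.range φ.toLinearMap) fun a =>
      hφrange ▸ hf.map_mem 0 _ (hd.d_mem 0 _ (hφ0 a))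
  have hδ : ∀ a, φ (δ a) = f (d (φ a)) := fun a =>
    congrArg Subtype.val (e.apply_symm_apply _)
  have hδ_mul : ∀ a b, δ (a * b) = δ a * b + a * δ b := fun a b => hφinj <| by
    simp [hδ, hd.map_mul, hf.map_mul, paritySign_of_mem_zero ℬ (hφ0 a),
      hf.map_zero_deg _ (hφ0 a), hf.map_zero_deg _ (hφ0 b)]
  obtain ⟨F, hF, hFD⟩ := E.exists_contraction (E.ι.toLinearMap ∘ₗ δ)
    (fun a => E.ι_mem_zero _) (fun a b => by simp [hδ_mul])
  refine ⟨F, hF, DFunLike.congr_fun (E.contraction_ext hd hπ hπd (hF.comp_hom hπ)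
    (hf.hom_comp hπ) fun a => ?_)⟩
  simp [hFD, hπι, hδ, hπd]

end GDEnvelope

/-- Let `Ω` be a graded differential algebra generated in degree `0` by
the algebra `A = Ω⁰` (here `φ : A →ₐ Ω` identifies `A` with the degree `0` part of `Ω`,
and `Ω` is generated by `A` as a graded differential algebra, i.e. by `φ(A) ∪ d(φ(A))`
as an algebra).  Then every operation of `g` in `Ω` is the quotient, via the canonical
surjective homomorphism of graded differential algebras `π : Ω(A) → Ω`, of a unique
operation of `g` in the differential envelope `Ω(A)` (the graded differential envelope
`E` of `A` with the trivial grading). -/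
theorem stmt1 (K : Type) [Field K] (g : Type) [LieRing g] [LieAlgebra K g]
    [Module.Finite K g] (A : Type) [Ring A] [Algebra K A]
    (Ω : Type) [Ring Ω] [Algebra K Ω] (𝒜 : ℕ → Submodule K Ω) [GradedAlgebra 𝒜]
    (d : Ω →ₗ[K] Ω) (hΩ : IsGDA K Ω 𝒜 d)
    -- `A` is (isomorphic to) the degree-zero part of `Ω`:
    (φ : A →ₐ[K] Ω) (hφinj : Function.Injective φ)
    (hφrange : LinearMap.range φ.toLinearMap = 𝒜 0)
    -- `Ω` is generated in degree 0 as a graded differential algebra: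
    (hgen : Algebra.adjoin K ((𝒜 0 : Set Ω) ∪ (⇑d '' (𝒜 0 : Set Ω))) = ⊤)
    -- the differential envelope `Ω(A)`:
    (E : GDEnvelope K A (trivGrading K A))
    -- the canonical homomorphism of graded differential algebras `π : Ω(A) → Ω`
    -- extending `φ`; it is surjective since `Ω` is generated in degree 0:
    (π : E.W →ₐ[K] Ω)
    (hπgr : ∀ (n : ℕ), ∀ w ∈ E.grading n, π w ∈ 𝒜 n)
    (hπd : ∀ w, π (E.d w) = d (π w))
    (hπι : ∀ a, π (E.ι a) = φ a)
    (hπsurj : Function.Surjective π)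
    -- any operation of `g` in `Ω`:
    (i : g →ₗ[K] Module.End K Ω) (hi : IsLieOperation K g Ω 𝒜 d i) :
    ∃! iE : g →ₗ[K] Module.End K E.W,
      IsLieOperation K g E.W E.grading E.d iE ∧
      ∀ (X : g) (w : E.W), π (iE X w) = i X (π w) := by
  have hinj : Function.Injective fun a => π (E.ι a) := by simpa only [hπι] using hφinj
  choose F hF hFπ using fun X => E.exists_lift_contraction hΩ hφinj hφrange hπgr hπd hπι
    (hi.isContraction X)
  let iE : g →ₗ[K] Module.End K E.W :=
    { toFun := F
      map_add' := fun X Y => E.contraction_ext_of_comp π hinj (hF _) ((hF X).add (hF Y))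
        fun w => by simp [hFπ]
      map_smul' := fun c X => E.contraction_ext_of_comp π hinj (hF _) ((hF X).smul c)
        fun w => by simp [hFπ] }
  have hiE : ∀ X w, π (iE X w) = i X (π w) := hFπ
  refine ⟨iE, ⟨⟨fun X => (hF X).map_mem, fun X => (hF X).map_zero_deg,
    fun X n a b ha => (hF X).antider ha b, fun X Y => ?_⟩, hiE⟩, ?_⟩
  · refine E.contraction_ext_of_comp π hinj ((hF X).cartan_bracket E.isGDA (hF Y)) (hF _)
      fun w => ?_
    have h := DFunLike.congr_fun (hi.cartan X Y) (π w)
    simpa [hiE, hπd] using h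
  · rintro j ⟨hj, hjπ⟩
    ext1 X
    exact E.contraction_ext_of_comp π hinj (hj.isContraction X) (hF X) fun w =>
      (hjπ X w).trans (hFπ X w).symm
end

section
/- Let A be an ℕ-graded unital associative algebra over a field K and let Ω_gr(A) be its graded differential envelope. Then any homomorphism of graded algebras α : A → Ω of A into a graded differential algebra Ω has a unique extension Ω_gr(α) : Ω_gr(A) → Ω as a homomorphism of graded differential algebras. -/
open scoped TensorProduct DirectSum

namespace GradedEnvelope

section Sign

variable {K : Type} [Field K] {A : Type} [Ring A] [Algebra K A]
  (𝒜 : ℕ → Submodule K A) [GradedAlgebra 𝒜]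

/-- The degree involution of a graded algebra: multiplication by `(-1) ^ n` in degree `n`. -/
noncomputable def signHom : A →ₐ[K] A :=
  (DirectSum.toAlgebra K (fun n => 𝒜 n) (fun n => ((-1 : K) ^ n) • (𝒜 n).subtype)
    (by simp) (fun {m n} x y => by simp [smul_smul, pow_add, mul_comm])).comp
    (DirectSum.decomposeAlgEquiv 𝒜).toAlgHom

theorem signHom_of_mem {n : ℕ} {a : A} (ha : a ∈ 𝒜 n) : signHom 𝒜 a = ((-1 : K) ^ n) • a := by
  simp only [signHom, AlgHom.comp_apply, AlgEquiv.toAlgHom_apply,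
    DirectSum.decomposeAlgEquiv_apply, DirectSum.decompose_of_mem 𝒜 ha]
  exact DirectSum.toAddMonoid_of
    (fun n => (((-1 : K) ^ n) • (𝒜 n).subtype).toAddMonoidHom) n ⟨a, ha⟩

end Sign

variable {K : Type} [Field K] {A : Type} [Ring A] [Algebra K A] (𝒜 : ℕ → Submodule K A)

/-- The defining relations of the envelope on the tensor algebra of `A × A`; the first factor
carries the elements of `A`, the second their formal differentials. -/
inductive Rel : TensorAlgebra K (A × A) → TensorAlgebra K (A × A) → Prop
  | one : Rel (TensorAlgebra.ι K (1, 0)) 1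
  | mul (a b : A) : Rel (TensorAlgebra.ι K (a * b, 0))
      (TensorAlgebra.ι K (a, 0) * TensorAlgebra.ι K (b, 0))
  | leibniz (n : ℕ) (a b : A) (ha : a ∈ 𝒜 n) : Rel (TensorAlgebra.ι K (0, a * b))
      (TensorAlgebra.ι K (0, a) * TensorAlgebra.ι K (b, 0) +
        ((-1 : K) ^ n) • (TensorAlgebra.ι K (a, 0) * TensorAlgebra.ι K (0, b)))

/-- The underlying algebra of the graded differential envelope of `A`. -/
def Env : Type := RingQuot (Rel 𝒜)

noncomputable instance : Ring (Env 𝒜) := inferInstanceAs (Ring (RingQuot (Rel 𝒜)))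

noncomputable instance : Algebra K (Env 𝒜) := inferInstanceAs (Algebra K (RingQuot (Rel 𝒜)))

/-- The quotient map from the tensor algebra. -/
noncomputable def mk : TensorAlgebra K (A × A) →ₐ[K] Env 𝒜 := RingQuot.mkAlgHom K (Rel 𝒜)

theorem mk_eq_of_rel {x y : TensorAlgebra K (A × A)} (h : Rel 𝒜 x y) : mk 𝒜 x = mk 𝒜 y :=
  RingQuot.mkAlgHom_rel K h

/-- The canonical algebra homomorphism `A → Env 𝒜`. -/
noncomputable def incl : A →ₐ[K] Env 𝒜 :=
  AlgHom.ofLinearMap ((mk 𝒜).toLinearMap ∘ₗ TensorAlgebra.ι K ∘ₗ LinearMap.inl K A A)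
    (by simpa using mk_eq_of_rel 𝒜 Rel.one)
    (fun a b => by simpa using mk_eq_of_rel 𝒜 (Rel.mul a b))

/-- The formal differential `A → Env 𝒜`. -/
noncomputable def del : A →ₗ[K] Env 𝒜 :=
  (mk 𝒜).toLinearMap ∘ₗ TensorAlgebra.ι K ∘ₗ LinearMap.inr K A A

theorem incl_apply (a : A) : incl 𝒜 a = mk 𝒜 (TensorAlgebra.ι K (a, 0)) := rfl

theorem del_apply (a : A) : del 𝒜 a = mk 𝒜 (TensorAlgebra.ι K (0, a)) := rfl

theorem del_mul {n : ℕ} {a : A} (ha : a ∈ 𝒜 n) (b : A) :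
    del 𝒜 (a * b) = del 𝒜 a * incl 𝒜 b + ((-1 : K) ^ n) • (incl 𝒜 a * del 𝒜 b) := by
  simpa only [map_add, map_mul, map_smul, ← incl_apply, ← del_apply] using
    mk_eq_of_rel 𝒜 (Rel.leibniz n a b ha)

section Lift

variable {B : Type} [Semiring B] [Algebra K B]

/-- The universal property of `Env 𝒜` as an algebra. -/
noncomputable def lift (α : A →ₐ[K] B) (δ : A →ₗ[K] B)
    (h : ∀ (n : ℕ) (a b : A), a ∈ 𝒜 n →
      δ (a * b) = δ a * α b + ((-1 : K) ^ n) • (α a * δ b)) : Env 𝒜 →ₐ[K] B :=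
  RingQuot.liftAlgHom K ⟨TensorAlgebra.lift K (α.toLinearMap.coprod δ), by
    intro x y hxy
    induction hxy with
    | one => simp
    | mul a b => simp
    | leibniz n a b ha => simpa using h n a b ha⟩

variable (α : A →ₐ[K] B) (δ : A →ₗ[K] B)
    (h : ∀ (n : ℕ) (a b : A), a ∈ 𝒜 n →
      δ (a * b) = δ a * α b + ((-1 : K) ^ n) • (α a * δ b))

@[simp]
theorem lift_incl (a : A) : lift 𝒜 α δ h (incl 𝒜 a) = α a := by
  rw [incl_apply]
  exact (RingQuot.liftAlgHom_mkAlgHom_apply ..).trans (by simp)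

@[simp]
theorem lift_del (a : A) : lift 𝒜 α δ h (del 𝒜 a) = δ a := by
  rw [del_apply]
  exact (RingQuot.liftAlgHom_mkAlgHom_apply ..).trans (by simp)

variable {𝒜} in
theorem hom_ext {f g : Env 𝒜 →ₐ[K] B} (hi : ∀ a, f (incl 𝒜 a) = g (incl 𝒜 a))
    (hd : ∀ a, f (del 𝒜 a) = g (del 𝒜 a)) : f = g := by
  refine RingQuot.ringQuot_ext' K f g (TensorAlgebra.hom_ext (LinearMap.prod_ext ?_ ?_))
  · exact LinearMap.ext hi
  · exact LinearMap.ext hd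

end Lift

/-- Homogeneous elements of `Env 𝒜`, generated by those coming from `A` and their
differentials. -/
inductive IsHom : ℕ → Env 𝒜 → Prop
  | zero (n : ℕ) : IsHom n 0
  | add {n : ℕ} {x y : Env 𝒜} : IsHom n x → IsHom n y → IsHom n (x + y)
  | smul {n : ℕ} (c : K) {x : Env 𝒜} : IsHom n x → IsHom n (c • x)
  | one : IsHom 0 1
  | mul {m n : ℕ} {x y : Env 𝒜} : IsHom m x → IsHom n y → IsHom (m + n) (x * y)
  | incl {n : ℕ} {a : A} : a ∈ 𝒜 n → IsHom n (incl 𝒜 a)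
  | del {n : ℕ} {a : A} : a ∈ 𝒜 n → IsHom (n + 1) (del 𝒜 a)

/-- The grading of `Env 𝒜`. -/
def grading (n : ℕ) : Submodule K (Env 𝒜) where
  carrier := {x | IsHom 𝒜 n x}
  zero_mem' := IsHom.zero n
  add_mem' := IsHom.add
  smul_mem' c _ := IsHom.smul c

instance : SetLike.GradedMonoid (grading 𝒜) where
  one_mem := IsHom.one
  mul_mem _ _ _ _ := IsHom.mul

theorem incl_mem {n : ℕ} {a : A} (ha : a ∈ 𝒜 n) : incl 𝒜 a ∈ grading 𝒜 n := IsHom.incl ha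

theorem del_mem {n : ℕ} {a : A} (ha : a ∈ 𝒜 n) : del 𝒜 a ∈ grading 𝒜 (n + 1) := IsHom.del ha

variable {𝒜} in
theorem map_mem_of_incl_mem {Ω : Type} [Ring Ω] [Algebra K Ω] {ℬ : ℕ → Submodule K Ω}
    [GradedAlgebra ℬ] {d' : Ω →ₗ[K] Ω} (h : IsGDA K Ω ℬ d') {Φ : Env 𝒜 →ₐ[K] Ω}
    (hi : ∀ (n : ℕ), ∀ a ∈ 𝒜 n, Φ (incl 𝒜 a) ∈ ℬ n)
    (hd : ∀ a, Φ (del 𝒜 a) = d' (Φ (incl 𝒜 a)))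
    {n : ℕ} {x : Env 𝒜} (hx : IsHom 𝒜 n x) : Φ x ∈ ℬ n := by
  induction hx with
  | zero n => simp
  | add hx hy ihx ihy => rw [map_add]; exact add_mem ihx ihy
  | smul c hx ih => rw [map_smul]; exact Submodule.smul_mem _ c ih
  | one => rw [map_one]; exact SetLike.one_mem_graded ℬ
  | mul hx hy ihx ihy => rw [map_mul]; exact SetLike.mul_mem_graded ihx ihy
  | incl ha => exact hi _ _ ha
  | del ha => rw [hd]; exact h.d_mem _ _ (hi _ _ ha)

theorem of_grading_congr {m n : ℕ} (h : m = n) {x y : Env 𝒜} (hx : x ∈ grading 𝒜 m)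
    (hy : y ∈ grading 𝒜 n) (hxy : x = y) :
    DirectSum.of (fun n => grading 𝒜 n) m ⟨x, hx⟩ =
      DirectSum.of (fun n => grading 𝒜 n) n ⟨y, hy⟩ := by
  subst h hxy
  rfl

variable [GradedAlgebra 𝒜]

/-- The canonical homomorphism from `A` to the direct sum of the pieces of `Env 𝒜`. -/
noncomputable def inclSum : A →ₐ[K] ⨁ n, grading 𝒜 n :=
  (DirectSum.toAlgebra K (fun n => 𝒜 n)
    (fun n => DirectSum.lof K ℕ (fun n => grading 𝒜 n) n ∘ₗ
      (incl 𝒜).toLinearMap.restrict (fun _ => incl_mem 𝒜))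
    (by
      rw [DirectSum.one_def]
      exact of_grading_congr 𝒜 rfl _ _ (map_one (incl 𝒜)))
    (fun {m n} x y => by
      simp only [LinearMap.comp_apply, DirectSum.lof_eq_of, DirectSum.of_mul_of]
      exact of_grading_congr 𝒜 rfl _ _ (map_mul (incl 𝒜) _ _))).comp
    (DirectSum.decomposeAlgEquiv 𝒜).toAlgHom

/-- The formal differential with values in the direct sum of the pieces of `Env 𝒜`. -/
noncomputable def delSum : A →ₗ[K] ⨁ n, grading 𝒜 n :=
  DirectSum.toModule K ℕ _
    (fun n => DirectSum.lof K ℕ (fun n => grading 𝒜 n) (n + 1) ∘ₗ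
      (del 𝒜).restrict (fun _ => del_mem 𝒜)) ∘ₗ
    (DirectSum.decomposeLinearEquiv 𝒜).toLinearMap

theorem inclSum_of_mem {n : ℕ} {a : A} (ha : a ∈ 𝒜 n) :
    inclSum 𝒜 a = DirectSum.of (fun n => grading 𝒜 n) n ⟨incl 𝒜 a, incl_mem 𝒜 ha⟩ := by
  simp only [inclSum, AlgHom.comp_apply, AlgEquiv.toAlgHom_apply,
    DirectSum.decomposeAlgEquiv_apply, DirectSum.decompose_of_mem 𝒜 ha]
  exact DirectSum.toAddMonoid_of
    (fun n => (DirectSum.lof K ℕ (fun n => grading 𝒜 n) n ∘ₗ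
      (incl 𝒜).toLinearMap.restrict (fun _ => incl_mem 𝒜)).toAddMonoidHom) n ⟨a, ha⟩

theorem delSum_of_mem {n : ℕ} {a : A} (ha : a ∈ 𝒜 n) :
    delSum 𝒜 a = DirectSum.of (fun n => grading 𝒜 n) (n + 1) ⟨del 𝒜 a, del_mem 𝒜 ha⟩ := by
  simp only [delSum, LinearMap.comp_apply, LinearEquiv.coe_coe,
    DirectSum.decomposeLinearEquiv_apply, DirectSum.decompose_of_mem 𝒜 ha]
  rw [← DirectSum.lof_eq_of K, DirectSum.toModule_lof]
  rfl

theorem delSum_mul {n : ℕ} {a : A} (ha : a ∈ 𝒜 n) (b : A) :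
    delSum 𝒜 (a * b) =
      delSum 𝒜 a * inclSum 𝒜 b + ((-1 : K) ^ n) • (inclSum 𝒜 a * delSum 𝒜 b) := by
  induction b using DirectSum.Decomposition.inductionOn 𝒜 with
  | zero => simp
  | add b c hb hc => simp only [mul_add, map_add, hb, hc, smul_add]; abel
  | @homogeneous m b =>
    have hl : delSum 𝒜 a * inclSum 𝒜 (b : A) = DirectSum.of (fun n => grading 𝒜 n) (n + m + 1)
        ⟨del 𝒜 a * incl 𝒜 b, by
          have := SetLike.mul_mem_graded (del_mem 𝒜 ha) (incl_mem 𝒜 b.2)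
          rwa [add_right_comm] at this⟩ := by
      rw [delSum_of_mem 𝒜 ha, inclSum_of_mem 𝒜 b.2, DirectSum.of_mul_of]
      exact of_grading_congr 𝒜 (add_right_comm _ _ _) _ _ rfl
    have hr : inclSum 𝒜 a * delSum 𝒜 (b : A) = DirectSum.of (fun n => grading 𝒜 n) (n + m + 1)
        ⟨incl 𝒜 a * del 𝒜 b, by
          have := SetLike.mul_mem_graded (incl_mem 𝒜 ha) (del_mem 𝒜 b.2)
          rwa [← add_assoc] at this⟩ := by
      rw [delSum_of_mem 𝒜 b.2, inclSum_of_mem 𝒜 ha, DirectSum.of_mul_of]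
      exact of_grading_congr 𝒜 (add_assoc _ _ _).symm _ _ rfl
    rw [hl, hr, delSum_of_mem 𝒜 (SetLike.mul_mem_graded ha b.2), ← DirectSum.lof_eq_of K,
      ← DirectSum.lof_eq_of K, ← DirectSum.lof_eq_of K, ← map_smul, ← map_add]
    congr 1
    exact Subtype.ext (del_mul 𝒜 ha b)

theorem coe_inclSum (a : A) : DirectSum.coeAlgHom (grading 𝒜) (inclSum 𝒜 a) = incl 𝒜 a := by
  induction a using DirectSum.Decomposition.inductionOn 𝒜 with
  | zero => simp
  | add a b ha hb => simp only [map_add, ha, hb]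
  | homogeneous a => rw [inclSum_of_mem 𝒜 a.2, DirectSum.coeAlgHom_of]

theorem coe_delSum (a : A) : DirectSum.coeAlgHom (grading 𝒜) (delSum 𝒜 a) = del 𝒜 a := by
  induction a using DirectSum.Decomposition.inductionOn 𝒜 with
  | zero => simp
  | add a b ha hb => simp only [map_add, ha, hb]
  | homogeneous a => rw [delSum_of_mem 𝒜 a.2, DirectSum.coeAlgHom_of]

/-- The decomposition of `Env 𝒜` into homogeneous components. -/
noncomputable def decomp : Env 𝒜 →ₐ[K] ⨁ n, grading 𝒜 n :=
  lift 𝒜 (inclSum 𝒜) (delSum 𝒜) (fun _ _ b ha => delSum_mul 𝒜 ha b)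

theorem decomp_of_isHom {n : ℕ} {x : Env 𝒜} (hx : IsHom 𝒜 n x) :
    decomp 𝒜 x = DirectSum.of (fun n => grading 𝒜 n) n ⟨x, hx⟩ := by
  induction hx with
  | zero n => rw [map_zero]; exact (map_zero _).symm
  | add hx hy ihx ihy => rw [map_add, ihx, ihy, ← map_add]; rfl
  | smul c hx ih => rw [map_smul, ih, ← DirectSum.lof_eq_of K, ← map_smul]; rfl
  | one => rw [map_one, DirectSum.one_def]; rfl
  | mul hx hy ihx ihy => rw [map_mul, ihx, ihy, DirectSum.of_mul_of]; rfl
  | incl ha => rw [decomp, lift_incl, inclSum_of_mem 𝒜 ha]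
  | del ha => rw [decomp, lift_del, delSum_of_mem 𝒜 ha]

noncomputable instance : GradedAlgebra (grading 𝒜) :=
  GradedAlgebra.ofAlgHom (grading 𝒜) (decomp 𝒜)
    (hom_ext (fun a => by simp [decomp, coe_inclSum]) (fun a => by simp [decomp, coe_delSum]))
    (fun _ x => decomp_of_isHom 𝒜 x.2)

theorem signHom_incl (a : A) : signHom (grading 𝒜) (incl 𝒜 a) = incl 𝒜 (signHom 𝒜 a) := by
  induction a using DirectSum.Decomposition.inductionOn 𝒜 with
  | zero => simp
  | add a b ha hb => simp only [map_add, ha, hb]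
  | homogeneous a =>
    rw [signHom_of_mem _ (incl_mem 𝒜 a.2), signHom_of_mem 𝒜 a.2, map_smul]

theorem del_mul_eq_signHom (a b : A) :
    del 𝒜 (a * b) = signHom (grading 𝒜) (incl 𝒜 a) * del 𝒜 b + del 𝒜 a * incl 𝒜 b := by
  induction a using DirectSum.Decomposition.inductionOn 𝒜 with
  | zero => simp
  | add a c ha hc => simp only [add_mul, map_add, ha, hc]; abel
  | homogeneous a =>
    rw [signHom_of_mem _ (incl_mem 𝒜 a.2), del_mul 𝒜 a.2, smul_mul_assoc, add_comm]

/-- The restriction to `A` of the matrix encoding of the differential. -/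
noncomputable def matIncl : A →ₐ[K] Matrix (Fin 2) (Fin 2) (Env 𝒜) :=
  AlgHom.ofLinearMap
    { toFun a := !![signHom (grading 𝒜) (incl 𝒜 a), del 𝒜 a; 0, incl 𝒜 a]
      map_add' a b := by ext i j; fin_cases i <;> fin_cases j <;> simp
      map_smul' c a := by ext i j; fin_cases i <;> fin_cases j <;> simp }
    (by
      have h : del 𝒜 (1 : A) = 0 := by simpa using del_mul_eq_signHom 𝒜 1 1
      ext i j; fin_cases i <;> fin_cases j <;> simp [h])
    (fun a b => by
      ext i j
      fin_cases i <;> fin_cases j <;> simp [Matrix.mul_apply, Fin.sum_univ_two, del_mul_eq_signHom])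

/-- The matrix encoding of the differential on the elements `del 𝒜 a`. -/
noncomputable def matDel : A →ₗ[K] Matrix (Fin 2) (Fin 2) (Env 𝒜) where
  toFun a := !![signHom (grading 𝒜) (del 𝒜 a), 0; 0, del 𝒜 a]
  map_add' a b := by ext i j; fin_cases i <;> fin_cases j <;> simp
  map_smul' c a := by ext i j; fin_cases i <;> fin_cases j <;> simp

theorem matIncl_apply (a : A) :
    matIncl 𝒜 a = !![signHom (grading 𝒜) (incl 𝒜 a), del 𝒜 a; 0, incl 𝒜 a] := rfl

theorem matDel_apply (a : A) :
    matDel 𝒜 a = !![signHom (grading 𝒜) (del 𝒜 a), 0; 0, del 𝒜 a] := rfl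

/-- The algebra homomorphism `w ↦ !![±w, d w; 0, w]` encoding the differential. -/
noncomputable def matHom : Env 𝒜 →ₐ[K] Matrix (Fin 2) (Fin 2) (Env 𝒜) :=
  lift 𝒜 (matIncl 𝒜) (matDel 𝒜) (fun n a b ha => by
    simp only [matIncl_apply, matDel_apply]
    ext i j
    fin_cases i <;> fin_cases j <;>
      simp [del_mul 𝒜 ha,
        signHom_of_mem _ (del_mem 𝒜 ha), pow_succ])

/-- The differential of `Env 𝒜`. -/
noncomputable def diff : Env 𝒜 →ₗ[K] Env 𝒜 :=
  Matrix.entryLinearMap K (Env 𝒜) 0 1 ∘ₗ (matHom 𝒜).toLinearMap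

theorem diff_apply (w : Env 𝒜) : diff 𝒜 w = matHom 𝒜 w 0 1 := rfl

@[simp]
theorem diff_incl (a : A) : diff 𝒜 (incl 𝒜 a) = del 𝒜 a := by
  simp [diff_apply, matHom, matIncl_apply]

@[simp]
theorem diff_del (a : A) : diff 𝒜 (del 𝒜 a) = 0 := by
  simp [diff_apply, matHom, matDel_apply]

theorem matHom_diag {n : ℕ} {x : Env 𝒜} (hx : IsHom 𝒜 n x) :
    matHom 𝒜 x 0 0 = ((-1 : K) ^ n) • x ∧ matHom 𝒜 x 1 1 = x ∧ matHom 𝒜 x 1 0 = 0 := by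
  induction hx with
  | zero n => simp
  | add hx hy ihx ihy => simp [ihx, ihy]
  | smul c hx ih => simp [ih, smul_comm c]
  | one => simp
  | mul hx hy ihx ihy =>
    simp [Matrix.mul_apply, Fin.sum_univ_two, ihx, ihy, smul_smul, pow_add, mul_comm]
  | incl ha => simp [matHom, matIncl_apply, signHom_of_mem _ (incl_mem 𝒜 ha)]
  | del ha => simp [matHom, matDel_apply, signHom_of_mem _ (del_mem 𝒜 ha)]

theorem matHom_one_one (x : Env 𝒜) : matHom 𝒜 x 1 1 = x := by
  induction x using DirectSum.Decomposition.inductionOn (grading 𝒜) with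
  | zero => simp
  | add x y hx hy => simp [hx, hy]
  | homogeneous x => exact (matHom_diag 𝒜 x.2).2.1

theorem diff_mul {n : ℕ} {x : Env 𝒜} (hx : IsHom 𝒜 n x) (y : Env 𝒜) :
    diff 𝒜 (x * y) = diff 𝒜 x * y + ((-1 : K) ^ n) • (x * diff 𝒜 y) := by
  simp [diff_apply, Matrix.mul_apply, Fin.sum_univ_two, matHom_one_one, matHom_diag 𝒜 hx,
    add_comm]

theorem diff_one : diff 𝒜 1 = 0 := by
  simp [diff_apply]

theorem diff_mem {n : ℕ} {x : Env 𝒜} (hx : IsHom 𝒜 n x) : diff 𝒜 x ∈ grading 𝒜 (n + 1) := by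
  induction hx with
  | zero n => simp
  | add hx hy ihx ihy => rw [map_add]; exact add_mem ihx ihy
  | smul c hx ih => rw [map_smul]; exact Submodule.smul_mem _ c ih
  | one => simp [diff_one]
  | @mul m n x y hx hy ihx ihy =>
    rw [diff_mul 𝒜 hx]
    refine add_mem ?_ (Submodule.smul_mem _ _ ?_)
    · rw [add_right_comm]
      exact SetLike.mul_mem_graded ihx hy
    · rw [add_assoc]
      exact SetLike.mul_mem_graded hx ihy
  | incl ha => rw [diff_incl]; exact del_mem 𝒜 ha
  | del ha => simp

theorem diff_diff (x : Env 𝒜) : diff 𝒜 (diff 𝒜 x) = 0 := by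
  induction x using DirectSum.Decomposition.inductionOn (grading 𝒜) with
  | zero => simp
  | add x y hx hy => simp [hx, hy]
  | homogeneous x =>
    obtain ⟨x, hx⟩ := x
    change IsHom 𝒜 _ x at hx
    change diff 𝒜 (diff 𝒜 x) = 0
    induction hx with
    | zero n => simp
    | add hx hy ihx ihy => simp [ihx, ihy]
    | smul c hx ih => simp [ih]
    | one => simp [diff_one]
    | mul hx hy ihx ihy =>
      simp [diff_mul 𝒜 hx, diff_mul 𝒜 (diff_mem 𝒜 hx), ihx, ihy, pow_succ]
    | incl ha => simp
    | del ha => simp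

theorem isGDA : IsGDA K (Env 𝒜) (grading 𝒜) (diff 𝒜) where
  d_mem _ _ := diff_mem 𝒜
  d_sq := diff_diff 𝒜
  leibniz _ _ b ha := diff_mul 𝒜 ha b

variable {𝒜} in
theorem map_diff {Ω : Type} [Ring Ω] [Algebra K Ω] {ℬ : ℕ → Submodule K Ω}
    [GradedAlgebra ℬ] {d' : Ω →ₗ[K] Ω} (h : IsGDA K Ω ℬ d') {Φ : Env 𝒜 →ₐ[K] Ω}
    (hi : ∀ (n : ℕ), ∀ a ∈ 𝒜 n, Φ (incl 𝒜 a) ∈ ℬ n)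
    (hd : ∀ a, Φ (del 𝒜 a) = d' (Φ (incl 𝒜 a))) (x : Env 𝒜) : Φ (diff 𝒜 x) = d' (Φ x) := by
  induction x using DirectSum.Decomposition.inductionOn (grading 𝒜) with
  | zero => simp
  | add x y hx hy => simp [hx, hy]
  | homogeneous x =>
    obtain ⟨x, hx⟩ := x
    change IsHom 𝒜 _ x at hx
    change Φ (diff 𝒜 x) = d' (Φ x)
    induction hx with
    | zero n => simp
    | add hx hy ihx ihy => simp [ihx, ihy]
    | smul c hx ih => simp [ih]
    | one =>
      have := h.leibniz 0 1 1 (SetLike.one_mem_graded ℬ)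
      simp_all [diff_one]
    | mul hx hy ihx ihy =>
      simp [diff_mul 𝒜 hx, h.leibniz _ _ _ (map_mem_of_incl_mem h hi hd hx), ihx, ihy]
    | incl ha => simp [hd]
    | del ha => simp [hd, h.d_sq]

/-- `Env 𝒜` is a graded differential envelope of `A`. -/
noncomputable def envelope : GDEnvelope K A 𝒜 where
  W := Env 𝒜
  ringW := inferInstance
  algW := inferInstance
  grading := grading 𝒜
  gradedW := inferInstance
  d := diff 𝒜
  isGDA := isGDA 𝒜
  ι := incl 𝒜
  ι_grading _ _ := incl_mem 𝒜
  univ Ω _ _ ℬ _ d' h α hα := by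
    let Φ : Env 𝒜 →ₐ[K] Ω := lift 𝒜 α (d' ∘ₗ α.toLinearMap)
      (fun n a b ha => by simpa using h.leibniz n (α a) (α b) (hα n a ha))
    have hi : ∀ a, Φ (incl 𝒜 a) = α a := fun a => lift_incl ..
    have hd : ∀ a, Φ (del 𝒜 a) = d' (α a) := fun a => lift_del ..
    have hmem : ∀ (n : ℕ), ∀ a ∈ 𝒜 n, Φ (incl 𝒜 a) ∈ ℬ n := fun n a ha => by
      rw [hi]; exact hα n a ha
    have hd' : ∀ a, Φ (del 𝒜 a) = d' (Φ (incl 𝒜 a)) := fun a => by rw [hi, hd]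
    refine ⟨Φ, ⟨fun _ _ => map_mem_of_incl_mem h hmem hd', map_diff h hmem hd', hi⟩, ?_⟩
    rintro Ψ ⟨-, hΨd, hΨi⟩
    refine hom_ext (fun a => by rw [hΨi, hi]) (fun a => ?_)
    rw [← diff_incl, hΨd, hΨi, diff_incl, hd]

end GradedEnvelope

/-- **Statement 14.** Let `A` be an ℕ-graded unital associative algebra over `K`.
Then the graded differential envelope `Ω_gr(A)` of `A` exists: there is a graded
differential algebra `W` together with a degree-preserving algebra homomorphism
`ι : A → W` such that any homomorphism of graded algebras `α : A → Ω` of `A` into a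
graded differential algebra `Ω` has a unique extension `Ω_gr(α) : W → Ω` as a
homomorphism of graded differential algebras (this universal property is the content of
the `univ` field of `GDEnvelope`). -/
theorem stmt14 (K : Type) [Field K] (A : Type) [Ring A] [Algebra K A]
    (𝒜 : ℕ → Submodule K A) [GradedAlgebra 𝒜] :
    Nonempty (GDEnvelope K A 𝒜) := by
  exact ⟨GradedEnvelope.envelope 𝒜⟩
end
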